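/- arXiv:2603.14735 — 2 statements merged into one kernel-verified Lean document; each statement's English description precedes it below -/
import Mathlib

section
/- Let (L, ∘_λ, [·_λ·]) be a transposed Poisson conformal algebra. Then for all x, y, z, h ∈ L the identity [[x_γ y]_μ (h∘_λ z)] + [[y_{μ−γ} z]_{−∂−λ−γ} (h∘_λ x)] + [[z_{−∂−γ} x]_{−∂−λ−μ+γ} (h∘_λ y)] = 0 holds (as an identity of polynomials in λ, μ, γ with coefficients in L, where substitutions of the λ-variable by expressions involving ∂ are interpreted via the ℂ[∂]-module action). -/
/-!
We model a `ℂ[∂]`-module as a complex vector space `L` together with an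
endomorphism `D` (the action of `∂`).  A `λ`-product (or `λ`-bracket) is a
`ℂ`-bilinear map `L → L → L[λ]`, where the polynomial `x ∘_λ y = Σₙ λⁿ • cₙ`
is encoded by its finitely supported family of coefficients `ℕ →₀ L`.
Substitution of the variable `λ` by a complex scalar, or by an operator such
as `-∂-λ`, is given by `ev`; since `ℂ` is infinite, an identity of
polynomials in (several) variables `λ, μ, γ` with coefficients in a complex
vector space holds formally if and only if it holds for all complex values
of the variables, which is how all identities are stated below.
-/

namespace ConfFormal

variable {L : Type*} [AddCommGroup L] [Module ℂ L]

/-- Evaluation of a polynomial `p = Σₙ λⁿ • pₙ` with coefficients in `L`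
(encoded as the family of its coefficients) at an endomorphism `T` of `L`
(for instance at a scalar `λ`, or at an operator such as `-∂-λ`). -/
noncomputable def ev (T : Module.End ℂ L) (p : ℕ →₀ L) : L :=
  p.sum fun n x => (T ^ n) x

/-- `app m T x y` is `x ∘_T y` : the `λ`-product `x ∘_λ y` recorded by the
`ℂ`-bilinear coefficient map `m`, with the variable `λ` substituted by the
endomorphism `T`. -/
noncomputable def app (m : L →ₗ[ℂ] L →ₗ[ℂ] (ℕ →₀ L)) (T : Module.End ℂ L) (x y : L) : L :=
  ev T (m x y)

/-- The scalar `c` viewed as an endomorphism of `L`. -/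
noncomputable def sc (c : ℂ) : Module.End ℂ L := c • (1 : Module.End ℂ L)

/-- `(L, D, m)` is a conformal algebra: conformal sesquilinearity holds. -/
structure IsConfAlg (D : Module.End ℂ L) (m : L →ₗ[ℂ] L →ₗ[ℂ] (ℕ →₀ L)) : Prop where
  sesq_left : ∀ (x y : L) (l : ℂ), app m (sc l) (D x) y = -l • app m (sc l) x y
  sesq_right : ∀ (x y : L) (l : ℂ),
    app m (sc l) x (D y) = D (app m (sc l) x y) + l • app m (sc l) x y

/-- `(L, D, m)` is a commutative associative conformal algebra. -/
structure IsCommAssocConfAlg (D : Module.End ℂ L) (m : L →ₗ[ℂ] L →ₗ[ℂ] (ℕ →₀ L))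
    extends IsConfAlg D m : Prop where
  assoc : ∀ (x y z : L) (l u : ℂ),
    app m (sc l) x (app m (sc u) y z) = app m (sc (l + u)) (app m (sc l) x y) z
  comm : ∀ (x y : L) (l : ℂ), app m (sc l) x y = app m (-(D + sc l)) y x

/-- `(L, D, br)` is a Lie conformal algebra. -/
structure IsLieConfAlg (D : Module.End ℂ L) (br : L →ₗ[ℂ] L →ₗ[ℂ] (ℕ →₀ L)) : Prop where
  sesq_left : ∀ (x y : L) (l : ℂ), app br (sc l) (D x) y = -l • app br (sc l) x y
  skew : ∀ (x y : L) (l : ℂ), app br (sc l) x y = -app br (-(sc l + D)) y x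
  jacobi : ∀ (x y z : L) (l u : ℂ),
    app br (sc l) x (app br (sc u) y z) =
      app br (sc (l + u)) (app br (sc l) x y) z + app br (sc u) y (app br (sc l) x z)

/-- `(L, D, m, br)` is a transposed Poisson conformal algebra. -/
structure IsTPCA (D : Module.End ℂ L) (m br : L →ₗ[ℂ] L →ₗ[ℂ] (ℕ →₀ L)) : Prop where
  commAssoc : IsCommAssocConfAlg D m
  lie : IsLieConfAlg D br
  tLeibniz : ∀ (x y z : L) (l u : ℂ),
    (2 : ℂ) • app m (sc l) x (app br (sc u) y z) =
      app br (sc (l + u)) (app m (sc l) x y) z + app br (sc u) y (app m (sc l) x z)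


lemma ev_add (T : Module.End ℂ L) (p q : ℕ →₀ L) : ev T (p + q) = ev T p + ev T q :=
  Finsupp.sum_add_index' (fun _ => map_zero _) fun _ _ _ => map_add _ _ _

lemma ev_smul (T : Module.End ℂ L) (c : ℂ) (p : ℕ →₀ L) : ev T (c • p) = c • ev T p := by
  unfold ev
  rw [Finsupp.sum_smul_index' fun _ => map_zero _, Finsupp.smul_sum]
  simp only [map_smul]

section Bilinear

variable (m : L →ₗ[ℂ] L →ₗ[ℂ] (ℕ →₀ L)) (T : Module.End ℂ L)

lemma app_add_left (x x' y : L) : app m T (x + x') y = app m T x y + app m T x' y := by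
  simp [app, ev_add]

lemma app_add_right (x y y' : L) : app m T x (y + y') = app m T x y + app m T x y' := by
  simp [app, ev_add]

lemma app_smul_left (c : ℂ) (x y : L) : app m T (c • x) y = c • app m T x y := by
  simp [app, ev_smul]

lemma app_smul_right (c : ℂ) (x y : L) : app m T x (c • y) = c • app m T x y := by
  simp [app, ev_smul]

lemma app_neg_right (x y : L) : app m T x (-y) = -app m T x y := by
  simpa using app_smul_right m T (-1) x y

end Bilinear

lemma IsLieConfAlg.app_neg_D_add {D : Module.End ℂ L} {br : L →ₗ[ℂ] L →ₗ[ℂ] (ℕ →₀ L)}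
    (hL : IsLieConfAlg D br) (x y : L) (c : ℂ) :
    app br (-(D + sc c)) x y = -app br (sc c) y x := by
  rw [hL.skew y x c, neg_neg, add_comm]

/-- The identity `[[x_a y]_{a+b} (h∘_l z)] + [(h∘_l y)_{l+b} [x_a z]] = [(h∘_l x)_{l+a} [y_b z]]`,
in which `∂` does not occur. -/
lemma IsTPCA.bracket_bracket_app {D : Module.End ℂ L} {m br : L →ₗ[ℂ] L →ₗ[ℂ] (ℕ →₀ L)}
    (hT : IsTPCA D m br) (x y z h : L) (l a b : ℂ) :
    app br (sc (a + b)) (app br (sc a) x y) (app m (sc l) h z)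
        + app br (sc (l + b)) (app m (sc l) h y) (app br (sc a) x z) =
      app br (sc (l + a)) (app m (sc l) h x) (app br (sc b) y z) := by
  have J := hT.lie.jacobi
  have P := hT.tLeibniz
  have jac_hz := J x y (app m (sc l) h z) a b
  have jac_hx := J (app m (sc l) h x) y z (l + a) b
  have jac_hy := J x (app m (sc l) h y) z a (l + b)
  have h_jac := congrArg (app m (sc l) h) (J x y z a b)
  rw [app_add_right] at h_jac
  have leib_x := P h x (app br (sc b) y z) l a
  have leib_y := P h y (app br (sc a) x z) l b
  have leib_xy := P h (app br (sc a) x y) z l (a + b)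
  have x_leib := congrArg (app br (sc a) x) (P h y z l b)
  have y_leib := congrArg (app br (sc b) y) (P h x z l a)
  have leib_z := congrArg (fun w => app br (sc (l + (a + b))) w z) (P h x y l a)
  simp only [app_add_right, app_add_left, app_smul_left, app_smul_right] at x_leib y_leib leib_z
  rw [add_assoc] at jac_hx
  rw [add_left_comm] at jac_hy
  linear_combination (norm := module) (-4 : ℂ) • h_jac + (2 : ℂ) • leib_x - (2 : ℂ) • leib_y
    - (2 : ℂ) • leib_xy + x_leib - y_leib - leib_z + jac_hz + jac_hx + jac_hy

/-- In a transposed Poisson conformal algebra,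
`[[x_γ y]_μ (h∘_λ z)] + [[y_{μ−γ} z]_{−∂−λ−γ} (h∘_λ x)]
  + [[z_{−∂−γ} x]_{−∂−λ−μ+γ} (h∘_λ y)] = 0`. -/
theorem tpca_identity_equ {L : Type*} [AddCommGroup L] [Module ℂ L]
    (D : Module.End ℂ L) (m br : L →ₗ[ℂ] L →ₗ[ℂ] (ℕ →₀ L))
    (hT : IsTPCA D m br) :
    ∀ (x y z h : L) (l u g : ℂ),
      app br (sc u) (app br (sc g) x y) (app m (sc l) h z)
        + app br (-(D + sc (l + g))) (app br (sc (u - g)) y z) (app m (sc l) h x)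
        + app br (-(D + sc (l + u - g))) (app br (-(D + sc g)) z x) (app m (sc l) h y) = 0 := by
  intro x y z h l u g
  have key := hT.bracket_bracket_app x y z h l g (u - g)
  rw [add_sub_cancel, ← add_sub_assoc] at key
  simp only [hT.lie.app_neg_D_add, app_neg_right]
  linear_combination (norm := module) key

end ConfFormal
end

section
/- Let (L, ∘_λ, [·_λ·]) be a transposed Poisson conformal algebra. Then for all x, y, u, v ∈ L the identity x∘_{μ−λ}[u_λ (v∘_γ y)] + [(v∘_γ x)_{γ+μ−λ} u]∘_{γ+μ} y = (u∘_λ v)∘_{λ+γ}[x_{μ−λ} y] holds (as an identity of polynomials in λ, μ, γ with coefficients in L, where substitutions of the λ-variable by expressions involving ∂ are interpreted via the ℂ[∂]-module action). -/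
/-!
We model a `ℂ[∂]`-module as a complex vector space `L` together with an
endomorphism `D` (the action of `∂`).  A `λ`-product (or `λ`-bracket) is a
`ℂ`-bilinear map `L → L → L[λ]`, where the polynomial `x ∘_λ y = Σₙ λⁿ • cₙ`
is encoded by its finitely supported family of coefficients `ℕ →₀ L`.
Substitution of the variable `λ` by a complex scalar, or by an operator such
as `-∂-λ`, is given by `ev`; since `ℂ` is infinite, an identity of
polynomials in (several) variables `λ, μ, γ` with coefficients in a complex
vector space holds formally if and only if it holds for all complex values
of the variables, which is how all identities are stated below.
-/

namespace ConfFormal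

variable {L : Type*} [AddCommGroup L] [Module ℂ L]

/-- `ev T` as a linear map. -/
noncomputable def evLin (T : Module.End ℂ L) : (ℕ →₀ L) →ₗ[ℂ] L :=
  Finsupp.lsum ℂ fun n => T ^ n

lemma evLin_apply (T : Module.End ℂ L) (p : ℕ →₀ L) : evLin T p = ev T p := by
  simp [evLin, ev]

/-- `y ↦ x ∘_T y` as a linear map. -/
noncomputable def appRight (m : L →ₗ[ℂ] L →ₗ[ℂ] (ℕ →₀ L)) (T : Module.End ℂ L) (x : L) :
    L →ₗ[ℂ] L :=
  evLin T ∘ₗ m x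

lemma appRight_apply (m : L →ₗ[ℂ] L →ₗ[ℂ] (ℕ →₀ L)) (T : Module.End ℂ L) (x y : L) :
    appRight m T x y = app m T x y := evLin_apply _ _

/-- `x ↦ x ∘_T y` as a linear map. -/
noncomputable def appLeft (m : L →ₗ[ℂ] L →ₗ[ℂ] (ℕ →₀ L)) (T : Module.End ℂ L) (y : L) :
    L →ₗ[ℂ] L :=
  evLin T ∘ₗ m.flip y

lemma appLeft_apply (m : L →ₗ[ℂ] L →ₗ[ℂ] (ℕ →₀ L)) (T : Module.End ℂ L) (x y : L) :
    appLeft m T y x = app m T x y := evLin_apply _ _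

lemma sc_apply (c : ℂ) (x : L) : sc c x = c • x := by simp [sc]

lemma sc_add (a b : ℂ) : (sc (a + b) : Module.End ℂ L) = sc a + sc b := by
  simp [sc, add_smul]

lemma commute_sc (c : ℂ) (T : Module.End ℂ L) : Commute T (sc c) :=
  (Commute.one_right T).smul_right c

lemma map_pow_apply_of_intertwines {f S T : Module.End ℂ L} (h : ∀ z, f (S z) = T (f z)) (n : ℕ)
    (z : L) : f ((S ^ n) z) = (T ^ n) (f z) := by
  induction n generalizing z with
  | zero => simp
  | succ n ih => rw [pow_succ, pow_succ, Module.End.mul_apply, Module.End.mul_apply, ih, h]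

lemma map_ev_of_intertwines {f S T : Module.End ℂ L} (h : ∀ z, f (S z) = T (f z))
    (p : ℕ →₀ L) : f (ev S p) = p.sum fun n z => (T ^ n) (f z) := by
  simp only [ev, Finsupp.sum, map_sum, map_pow_apply_of_intertwines h]

lemma map_ev_of_map_D {f D : Module.End ℂ L} {s : ℂ} (h : ∀ z, f (D z) = -s • f z) (c : ℂ)
    (p : ℕ →₀ L) : f (ev (-(D + sc c)) p) = f (ev (sc (s - c)) p) := by
  rw [map_ev_of_intertwines (T := sc (s - c)), map_ev_of_intertwines (T := sc (s - c))]
  · intro z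
    simp [sc_apply]
  · intro z
    simp only [LinearMap.neg_apply, LinearMap.add_apply, map_neg, map_add, h, sc_apply, map_smul]
    module

/-- The pairs `(l ↦ p(l), p(T))`, where `p` runs over the polynomials with coefficients in `L`. -/
noncomputable def substGraph (T : Module.End ℂ L) : Submodule ℂ ((ℂ → L) × L) :=
  LinearMap.range ((LinearMap.pi fun l => evLin (sc l)).prod (evLin T))

lemma mem_substGraph {T : Module.End ℂ L} {F : ℂ → L} {z : L} :
    (F, z) ∈ substGraph T ↔ ∃ p, (∀ l, ev (sc l) p = F l) ∧ ev T p = z := by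
  simp [substGraph, funext_iff, evLin_apply]

lemma eq_zero_of_ev_sc {p : ℕ →₀ L} (h : ∀ l : ℂ, ev (sc l) p = 0) : p = 0 := by
  ext n
  rw [Finsupp.zero_apply, ← Module.forall_dual_apply_eq_zero_iff ℂ]
  intro φ
  have hq : (∑ i ∈ p.support, Polynomial.monomial i (φ (p i))) = 0 := by
    apply Polynomial.funext
    intro l
    have := congrArg φ (h l)
    have hs (i : ℕ) : (sc l : Module.End ℂ L) ^ i = (l ^ i) • 1 := by simp [sc, smul_pow]
    simp only [ev, Finsupp.sum, map_sum, map_zero, hs, LinearMap.smul_apply,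
      Module.End.one_apply, map_smul, smul_eq_mul] at this
    simpa [Polynomial.eval_finsetSum, mul_comm] using this
  have := congrArg (fun q => Polynomial.coeff q n) hq
  simp only [Polynomial.finsetSum_coeff, Polynomial.coeff_monomial, Finset.sum_ite_eq',
    Polynomial.coeff_zero] at this
  by_cases hn : n ∈ p.support
  · simpa [hn] using this
  · simp [Finsupp.notMem_support_iff.mp hn]

lemma substGraph_unique {T : Module.End ℂ L} {F : ℂ → L} {z z' : L}
    (h : (F, z) ∈ substGraph T) (h' : (F, z') ∈ substGraph T) : z = z' := by
  obtain ⟨p, hp, rfl⟩ := mem_substGraph.mp h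
  obtain ⟨q, hq, rfl⟩ := mem_substGraph.mp h'
  have : p - q = 0 := eq_zero_of_ev_sc fun l => by
    rw [← evLin_apply, map_sub, evLin_apply, evLin_apply, hp, hq, sub_self]
  rw [sub_eq_zero.mp this]

lemma const_mem_substGraph (T : Module.End ℂ L) (z : L) : ((fun _ => z), z) ∈ substGraph T :=
  mem_substGraph.mpr ⟨Finsupp.single 0 z, by simp [ev]⟩

lemma smul_mem_substGraph {T : Module.End ℂ L} {F : ℂ → L} {z : L} (h : (F, z) ∈ substGraph T) :
    ((fun l => l • F l), T z) ∈ substGraph T := by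
  obtain ⟨p, hp, rfl⟩ := mem_substGraph.mp h
  have key (S : Module.End ℂ L) : ev S (p.mapDomain (· + 1)) = S (ev S p) := by
    rw [ev, Finsupp.sum_mapDomain_index (by simp) (by simp), ev, Finsupp.sum, Finsupp.sum, map_sum]
    simp [pow_succ']
  exact mem_substGraph.mpr ⟨p.mapDomain (· + 1), fun l => by rw [key, hp, sc_apply], key T⟩

lemma map_mem_substGraph {T S : Module.End ℂ L} {F : ℂ → L} {z : L} (h : (F, z) ∈ substGraph T)
    (hS : Commute S T) : ((fun l => S (F l)), S z) ∈ substGraph T := by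
  obtain ⟨p, hp, rfl⟩ := mem_substGraph.mp h
  have key (R : Module.End ℂ L) (hR : Commute S R) :
      ev R (p.mapRange S (map_zero S)) = S (ev R p) := by
    rw [map_ev_of_intertwines (T := R) (fun z => LinearMap.congr_fun hR z), ev,
      Finsupp.sum_mapRange_index (by simp)]
  exact mem_substGraph.mpr
    ⟨p.mapRange S (map_zero S), fun l => by rw [key _ (commute_sc l S), hp], key T hS⟩

lemma pow_smul_mem_substGraph {T : Module.End ℂ L} {F : ℂ → L} {z : L}
    (h : (F, z) ∈ substGraph T) (n : ℕ) :
    ((fun l => l ^ n • F l), (T ^ n) z) ∈ substGraph T := by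
  induction n with
  | zero => simpa using h
  | succ n ih => simpa [pow_succ', mul_smul] using smul_mem_substGraph ih

lemma shift_pow_mem_substGraph {T D : Module.End ℂ L} (hD : Commute D T) (a : ℂ) (z : L) (k : ℕ) :
    ((fun l => ((-(sc (l + a) + D) : Module.End ℂ L) ^ k) z),
      ((-(T + sc a + D) : Module.End ℂ L) ^ k) z) ∈ substGraph T := by
  induction k with
  | zero => simpa using const_mem_substGraph T z
  | succ k ih =>
    have h := neg_mem (add_mem (add_mem (smul_mem_substGraph ih)
      (map_mem_substGraph ih (commute_sc a T).symm)) (map_mem_substGraph ih hD))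
    convert h using 1
    ext1
    · funext l
      simp [pow_succ', sc_apply, add_smul]
    · simp [pow_succ']

lemma sum_mem_substGraph {T : Module.End ℂ L} {ι : Type*} (s : Finset ι) {F : ι → ℂ → L}
    {z : ι → L} (h : ∀ i ∈ s, (F i, z i) ∈ substGraph T) :
    ((fun l => ∑ i ∈ s, F i l), ∑ i ∈ s, z i) ∈ substGraph T := by
  have := sum_mem h
  convert this using 1
  ext1
  · funext l
    simp [Prod.fst_sum]
  · simp [Prod.snd_sum]

lemma app_shift_mem_substGraph {T D : Module.End ℂ L} (hD : Commute D T)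
    (br : L →ₗ[ℂ] L →ₗ[ℂ] (ℕ →₀ L)) (a : ℂ) (u z : L) :
    ((fun l => app br (-(sc (l + a) + D)) u z), app br (-(T + sc a + D)) u z) ∈ substGraph T :=
  sum_mem_substGraph _ fun k _ => shift_pow_mem_substGraph hD a (br u z k) k

lemma map_app_mem_substGraph {D A : Module.End ℂ L} {a : ℂ}
    (hA : ∀ z, A (D z) = D (A z) + a • A z) (m : L →ₗ[ℂ] L →ₗ[ℂ] (ℕ →₀ L)) (b : ℂ) (y u : L) :
    ((fun l => A (app m (sc l) y u)), A (app m (-(D + sc b)) y u)) ∈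
      substGraph (-(D + sc (a + b))) := by
  have key {S R : Module.End ℂ L} (h : ∀ z, A (S z) = R (A z)) :
      ev R ((m y u).mapRange A (map_zero A)) = A (app m S y u) := by
    rw [app, map_ev_of_intertwines h, ev, Finsupp.sum_mapRange_index (by simp)]
  refine mem_substGraph.mpr ⟨(m y u).mapRange A (map_zero A), fun l => key fun z => ?_,
    key fun z => ?_⟩
  · simp [sc_apply]
  · simp only [LinearMap.neg_apply, LinearMap.add_apply, map_neg, map_add, hA, sc_apply, map_smul]
    module

namespace IsLieConfAlg

variable {D : Module.End ℂ L} {br : L →ₗ[ℂ] L →ₗ[ℂ] (ℕ →₀ L)}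

lemma app_D_left (h : IsLieConfAlg D br) (x y : L) (T : Module.End ℂ L) :
    app br T (D x) y = -T (app br T x y) := by
  have h₁ (z : L) : ((fun l => app br (sc l) z y), app br T z y) ∈ substGraph T :=
    mem_substGraph.mpr ⟨br z y, fun _ => rfl, rfl⟩
  refine substGraph_unique (h₁ (D x)) ?_
  convert neg_mem (smul_mem_substGraph (h₁ x)) using 1
  ext1
  · funext l
    simp [h.sesq_left]
  · rfl

lemma sesq_right (h : IsLieConfAlg D br) (x y : L) (l : ℂ) :
    app br (sc l) x (D y) = D (app br (sc l) x y) + l • app br (sc l) x y := by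
  rw [h.skew x (D y), h.app_D_left, h.skew x y]
  simp only [LinearMap.neg_apply, LinearMap.add_apply, sc_apply, map_neg]
  module

lemma app_app_mem_substGraph (h : IsLieConfAlg D br) (m : L →ₗ[ℂ] L →ₗ[ℂ] (ℕ →₀ L))
    (a b : ℂ) (x y u : L) :
    ((fun l => app br (sc (l + a)) (app m (sc l) y x) u),
      -app br (sc b) u (app m (-(D + sc a)) y x)) ∈ substGraph (-(D + sc (a + b))) := by
  set T : Module.End ℂ L := -(D + sc (a + b)) with hT
  have hD : Commute D T := ((Commute.refl D).add_right (commute_sc _ D)).neg_right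
  have hb : -(T + sc a + D) = sc b := by
    rw [hT, sc_add]
    abel
  have h₁ := neg_mem (sum_mem_substGraph (m y x).support fun n _ =>
    pow_smul_mem_substGraph (app_shift_mem_substGraph hD br a u (m y x n)) n)
  convert h₁ using 1
  ext1
  · funext l
    have hs (n : ℕ) : (sc l : Module.End ℂ L) ^ n = (l ^ n) • 1 := by simp [sc, smul_pow]
    change app br (sc (l + a)) (app m (sc l) y x) u = _
    rw [← appLeft_apply, app, ev, Finsupp.sum, map_sum, Prod.fst_neg, Pi.neg_apply,
      ← Finset.sum_neg_distrib]
    refine Finset.sum_congr rfl fun n _ => ?_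
    rw [hs, LinearMap.smul_apply, Module.End.one_apply, map_smul, appLeft_apply, h.skew, smul_neg]
  · rw [hb, Prod.snd_neg, ← appRight_apply, app, map_ev_of_intertwines (T := T)]
    · simp only [appRight_apply]
      rfl
    · intro z
      simp only [hT, appRight_apply, LinearMap.neg_apply, LinearMap.add_apply, map_neg, map_add,
        h.sesq_right, sc_apply, map_smul]
      module

end IsLieConfAlg

namespace IsCommAssocConfAlg

variable {D : Module.End ℂ L} {m : L →ₗ[ℂ] L →ₗ[ℂ] (ℕ →₀ L)}

lemma map_app_comm (h : IsCommAssocConfAlg D m) {f : Module.End ℂ L} {a b : ℂ}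
    (hf : ∀ z, f (D z) = -(a + b) • f z) (x u : L) :
    f (app m (sc b) u x) = f (app m (sc a) x u) := by
  rw [h.comm u x, app, map_ev_of_map_D hf, add_sub_cancel_right, app]

lemma left_comm (h : IsCommAssocConfAlg D m) (x u y : L) (a b : ℂ) :
    app m (sc a) x (app m (sc b) u y) = app m (sc b) u (app m (sc a) x y) := by
  rw [h.assoc, h.assoc, add_comm b a, ← appLeft_apply, ← appLeft_apply]
  refine (h.map_app_comm (fun z => ?_) x u).symm
  rw [appLeft_apply, appLeft_apply, h.sesq_left]

end IsCommAssocConfAlg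

namespace IsTPCA

variable {D : Module.End ℂ L} {m br : L →ₗ[ℂ] L →ₗ[ℂ] (ℕ →₀ L)}

lemma two_smul_bracket_app (h : IsTPCA D m br) (x u y : L) (a b : ℂ) :
    (2 : ℂ) • app m (sc (a + b)) (app br (sc a) x u) y =
      app br (sc a) x (app m (sc b) u y) - app br (sc b) u (app m (sc a) x y) := by
  have h₁ := add_mem (h.lie.app_app_mem_substGraph m a b x y u)
    (map_app_mem_substGraph (A := appRight br (sc a) x) (a := a)
      (fun z => by simp only [appRight_apply, h.lie.sesq_right]) m b y u)
  have h₂ : ((fun l => (2 : ℂ) • app m (sc l) y (app br (sc a) x u)),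
      (2 : ℂ) • app m (-(D + sc (a + b))) y (app br (sc a) x u)) ∈
        substGraph (-(D + sc (a + b))) :=
    Submodule.smul_mem _ (2 : ℂ)
      (mem_substGraph.mpr ⟨m y (app br (sc a) x u), fun _ => rfl, rfl⟩)
  rw [h.commAssoc.comm (app br (sc a) x u), h.commAssoc.comm u, h.commAssoc.comm x]
  refine substGraph_unique h₂ ?_
  convert h₁ using 1
  ext1
  · funext l
    simp only [Prod.fst_add, Pi.add_apply, appRight_apply]
    exact h.tLeibniz y x u l a
  · simp only [Prod.snd_add, appRight_apply]
    abel

/-- The cyclic identity `[x, u] ∘ y = u ∘ [x, y] - x ∘ [u, y]`. -/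
lemma bracket_app (h : IsTPCA D m br) (x u y : L) (a b : ℂ) :
    app m (sc (a + b)) (app br (sc a) x u) y =
      app m (sc b) u (app br (sc a) x y) - app m (sc a) x (app br (sc b) u y) := by
  have h₁ := h.tLeibniz u x y b a
  have h₂ := h.tLeibniz x u y a b
  have h₃ : app br (sc (a + b)) (app m (sc b) u x) y =
      app br (sc (a + b)) (app m (sc a) x u) y := by
    rw [← appLeft_apply, ← appLeft_apply]
    refine h.commAssoc.map_app_comm (fun z => ?_) x u
    rw [appLeft_apply, appLeft_apply, h.lie.sesq_left]
  rw [add_comm b a, h₃] at h₁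
  have h2 : (2 : ℂ) ≠ 0 := two_ne_zero
  refine smul_right_injective L h2 ?_
  simp only [smul_sub, h₁, h₂, h.two_smul_bracket_app]
  abel

end IsTPCA

/-- In a transposed Poisson conformal algebra,
`x∘_{μ−λ}[u_λ (v∘_γ y)] + [(v∘_γ x)_{γ+μ−λ} u]∘_{γ+μ} y = (u∘_λ v)∘_{λ+γ}[x_{μ−λ} y]`. -/
theorem tpca_identity_ss2 {L : Type*} [AddCommGroup L] [Module ℂ L]
    (D : Module.End ℂ L) (m br : L →ₗ[ℂ] L →ₗ[ℂ] (ℕ →₀ L))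
    (hT : IsTPCA D m br) :
    ∀ (x y u v : L) (l mu g : ℂ),
      app m (sc (mu - l)) x (app br (sc l) u (app m (sc g) v y))
        + app m (sc (g + mu)) (app br (sc (g + mu - l)) (app m (sc g) v x) u) y
      = app m (sc (l + g)) (app m (sc l) u v) (app br (sc (mu - l)) x y) := by
  intro x y u v l mu g
  obtain ⟨a, rfl⟩ : ∃ a, mu = a + l := ⟨mu - l, by ring⟩
  have e : g + (a + l) = (g + a) + l := by ring
  rw [e, add_sub_cancel_right, add_sub_cancel_right, hT.bracket_app,
    ← hT.commAssoc.assoc v x, ← hT.commAssoc.assoc u v]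
  have h₁ := hT.bracket_app x u (app m (sc g) v y) a l
  have h₂ := congrArg (appRight m (sc g) v) (hT.bracket_app x u y a l)
  have h₃ := congrArg (appRight m (sc l) u) (hT.tLeibniz v x y g a)
  rw [map_sub] at h₂
  rw [map_add, map_smul] at h₃
  simp only [appRight_apply] at h₂ h₃
  rw [hT.commAssoc.left_comm v, hT.commAssoc.left_comm v u, h₁] at h₂
  rw [eq_sub_of_add_eq h₃.symm]
  linear_combination (norm := module) -h₂

end ConfFormal
end
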